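/- Let α ∈ (1,2], η ∈ (0,1], 0 ≤ λ < 2/η², and let f : [0,1] × [0,∞) → [0,∞) be continuous. Suppose min_{t∈[0,1]} f(t,x)/x → +∞ as x → 0⁺ and max_{t∈[0,1]} f(t,x)/x → 0 as x → +∞. Then there exists a continuous function x : [0,1] → ℝ with x(t) ≥ 0 for all t ∈ [0,1], x not identically zero, x twice differentiable on (0,1), satisfying t^(2-α)·x''(t) + f(t, x(t)) = 0 for all t ∈ (0,1), x(0) = 0, and x(1) = λ·∫₀^η x(t) dt. -/

import Mathlib

open Set MeasureTheory Filter Topology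

theorem exists_subseq_tendsto_of_equilipschitz (x : ℕ → ℝ → ℝ) (L C : ℝ)
    (hL : ∀ n, ∀ s ∈ Icc (0 : ℝ) 1, ∀ t ∈ Icc (0 : ℝ) 1, |x n s - x n t| ≤ L * |s - t|)
    (hC : ∀ n, ∀ t ∈ Icc (0 : ℝ) 1, |x n t| ≤ C) :
    ∃ (g : ℝ → ℝ) (φ : ℕ → ℕ), Continuous g ∧ StrictMono φ ∧
      ∀ t ∈ Icc (0 : ℝ) 1, Tendsto (fun n => x (φ n) t) atTop (𝓝 (g t)) := by
  have hLip : ∀ n, LipschitzWith L.toNNReal fun t : Icc (0 : ℝ) 1 => x n t := fun n =>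
    LipschitzWith.of_dist_le_mul fun s t => by
      rw [Real.dist_eq, Subtype.dist_eq, Real.dist_eq]
      exact (hL n s s.2 t t.2).trans (by gcongr; exact Real.le_coe_toNNReal L)
  let X : ℕ → BoundedContinuousFunction (Icc (0 : ℝ) 1) ℝ := fun n =>
    BoundedContinuousFunction.mkOfCompact ⟨fun t : Icc (0 : ℝ) 1 => x n t, (hLip n).continuous⟩
  have hcomp : IsCompact (closure (range X)) := by
    refine BoundedContinuousFunction.arzela_ascoli (Icc (-C) C) isCompact_Icc _ ?_ ?_
    · rintro _ t ⟨n, rfl⟩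
      exact abs_le.1 (hC n t t.2)
    · refine (LipschitzWith.uniformEquicontinuous _ L.toNNReal ?_).equicontinuous
      rintro ⟨_, n, rfl⟩
      exact hLip n
  obtain ⟨g, -, φ, hφ, hg⟩ := hcomp.tendsto_subseq fun n => subset_closure (mem_range_self n)
  refine ⟨IccExtend zero_le_one g, φ, g.continuous.Icc_extend', hφ, fun t ht => ?_⟩
  rw [IccExtend_of_mem _ _ ht]
  exact ((BoundedContinuousFunction.tendsto_iff_tendstoUniformly.1 hg).tendsto_at ⟨t, ht⟩)

section Concave

variable {x : ℝ → ℝ}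

theorem ConcaveOn.mul_le_mul_of_left_zero (hx : ConcaveOn ℝ (Icc 0 1) x) (h0 : 0 ≤ x 0) {s t : ℝ}
    (ht : 0 ≤ t) (hts : t ≤ s) (hs : s ≤ 1) : t * x s ≤ s * x t := by
  rcases hts.eq_or_lt with rfl | hlt
  · rfl
  have hs0 : 0 < s := ht.trans_lt hlt
  have h := hx.2 (left_mem_Icc.2 zero_le_one) ⟨hs0.le, hs⟩
    (sub_nonneg.2 ((div_le_one hs0).2 hts)) (div_nonneg ht hs0.le) (sub_add_cancel 1 (t / s))
  simp only [smul_eq_mul, mul_zero, zero_add, div_mul_cancel₀ _ hs0.ne'] at h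
  have h1 : t / s * x s ≤ x t :=
    le_trans (le_add_of_nonneg_left
      (mul_nonneg (sub_nonneg.2 ((div_le_one hs0).2 hts)) h0)) h
  calc t * x s = s * (t / s * x s) := by field_simp
    _ ≤ s * x t := by gcongr

theorem ConcaveOn.mul_le_mul_of_right_zero (hx : ConcaveOn ℝ (Icc 0 1) x) (h1 : 0 ≤ x 1) {s t : ℝ}
    (hs : 0 ≤ s) (hst : s ≤ t) (ht : t ≤ 1) : (1 - t) * x s ≤ (1 - s) * x t := by
  have hy : ConcaveOn ℝ (Icc 0 1) fun r => x (1 - r) := by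
    refine ⟨convex_Icc 0 1, fun a ha b hb p q hp hq hpq => ?_⟩
    have := hx.2 (x := 1 - a) (y := 1 - b) ⟨by linarith [ha.2], by linarith [ha.1]⟩
      ⟨by linarith [hb.2], by linarith [hb.1]⟩ hp hq hpq
    convert this using 2
    simp only [smul_eq_mul]
    linear_combination -hpq
  have := hy.mul_le_mul_of_left_zero (by simpa using h1) (s := 1 - s) (t := 1 - t)
    (by linarith) (by linarith) (by linarith)
  simpa using this

theorem ConcaveOn.mul_le_integral (hx : ConcaveOn ℝ (Icc 0 1) x) (hc : Continuous x)
    (h0 : x 0 = 0) {η : ℝ} (hη : η ∈ Ioc (0 : ℝ) 1) :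
    η ^ 2 / 2 * x 1 ≤ ∫ t in (0 : ℝ)..η, x t := by
  have h : ∫ t in (0 : ℝ)..η, t * x 1 = η ^ 2 / 2 * x 1 := by
    rw [intervalIntegral.integral_mul_const, integral_id]; ring
  rw [← h]
  refine intervalIntegral.integral_mono_on hη.1.le
    (Continuous.intervalIntegrable (by fun_prop) _ _) (hc.intervalIntegrable _ _) fun t ht => ?_
  simpa using hx.mul_le_mul_of_left_zero h0.ge ht.1 (ht.2.trans hη.2) le_rfl

theorem ConcaveOn.nonneg_of_endpoints (hx : ConcaveOn ℝ (Icc 0 1) x) (h0 : 0 ≤ x 0) (h1 : 0 ≤ x 1)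
    {t : ℝ} (ht : t ∈ Icc (0 : ℝ) 1) : 0 ≤ x t := by
  have := hx.mul_le_mul_of_left_zero h0 ht.1 ht.2 le_rfl
  nlinarith [mul_nonneg ht.1 h1]

end Concave

section Hinge

variable {μ : Measure ℝ} {w : ℝ → ℝ} {B : ℝ}

/-- For a density `w`, the convex function whose second derivative is `w • μ` and which vanishes
to the left of the support of `μ`. -/
noncomputable def hinge (μ : Measure ℝ) (w : ℝ → ℝ) (t : ℝ) : ℝ := ∫ s, max (t - s) 0 * w s ∂μ

theorem hinge_bound {s : ℝ} (hs : s ∈ Ioc (0 : ℝ) 1) (t : ℝ) : max (t - s) 0 ≤ |t| :=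
  max_le (by linarith [le_abs_self t, hs.1]) (abs_nonneg t)

theorem hinge_nonneg (hw : ∀ s, 0 ≤ w s) (t : ℝ) : 0 ≤ hinge μ w t :=
  integral_nonneg fun s => mul_nonneg (le_max_right _ _) (hw s)

theorem hinge_of_nonpos (hμ : ∀ᵐ s ∂μ, s ∈ Ioc (0 : ℝ) 1) {t : ℝ} (ht : t ≤ 0) :
    hinge μ w t = 0 := by
  refine integral_eq_zero_of_ae ?_
  filter_upwards [hμ] with s hs
  rw [max_eq_right (by linarith [hs.1]), zero_mul, Pi.zero_apply]

variable [IsFiniteMeasure μ]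

theorem integrable_hinge (hμ : ∀ᵐ s ∂μ, s ∈ Ioc (0 : ℝ) 1) (hw : Continuous w)
    (hB : ∀ s, |w s| ≤ B) (t : ℝ) : Integrable (fun s => max (t - s) 0 * w s) μ := by
  refine Integrable.mono' (integrable_const (|t| * B)) (by fun_prop) ?_
  filter_upwards [hμ] with s hs
  rw [norm_mul, Real.norm_eq_abs, Real.norm_eq_abs, abs_of_nonneg (le_max_right _ _)]
  gcongr
  exacts [hinge_bound hs t, hB s]

theorem convexOn_hinge (hμ : ∀ᵐ s ∂μ, s ∈ Ioc (0 : ℝ) 1) (hw : Continuous w)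
    (hB : ∀ s, |w s| ≤ B) (hw0 : ∀ s, 0 ≤ w s) : ConvexOn ℝ univ (hinge μ w) := by
  refine ⟨convex_univ, fun a _ b _ p q hp hq hpq => ?_⟩
  simp only [smul_eq_mul, hinge]
  have ha := (integrable_hinge hμ hw hB a).const_mul p
  have hb := (integrable_hinge hμ hw hB b).const_mul q
  rw [← integral_const_mul, ← integral_const_mul, ← integral_add ha hb]
  refine integral_mono (integrable_hinge hμ hw hB _) (ha.add hb) fun s => ?_
  have : max (p * a + q * b - s) 0 ≤ p * max (a - s) 0 + q * max (b - s) 0 := by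
    refine max_le ?_ (by positivity)
    calc p * a + q * b - s = p * (a - s) + q * (b - s) := by linear_combination s * hpq
      _ ≤ _ := by gcongr <;> exact le_max_left _ _
  calc _ ≤ _ := mul_le_mul_of_nonneg_right this (hw0 s)
    _ = _ := by ring

theorem abs_hinge_sub_le (hμ : ∀ᵐ s ∂μ, s ∈ Ioc (0 : ℝ) 1) (hw : Continuous w)
    (hB : ∀ s, |w s| ≤ B) (a b : ℝ) :
    |hinge μ w a - hinge μ w b| ≤ B * μ.real univ * |a - b| := by
  rw [hinge, hinge, ← integral_sub (integrable_hinge hμ hw hB a) (integrable_hinge hμ hw hB b),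
    ← Real.norm_eq_abs]
  refine (norm_integral_le_of_norm_le_const (C := |a - b| * B) (ae_of_all _ fun s => ?_)).trans_eq
    (by ring)
  rw [← sub_mul, norm_mul, Real.norm_eq_abs, Real.norm_eq_abs]
  refine mul_le_mul ?_ (hB s) (abs_nonneg _) (abs_nonneg _)
  simpa using abs_max_sub_max_le_abs (a - s) (b - s) 0

theorem hinge_one_le (hμ : ∀ᵐ s ∂μ, s ∈ Ioc (0 : ℝ) 1)
    (hw0 : ∀ s, 0 ≤ w s) (hB : ∀ s, w s ≤ B) : hinge μ w 1 ≤ B * μ.real univ := by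
  refine (le_abs_self _).trans ?_
  rw [← Real.norm_eq_abs]
  refine norm_integral_le_of_norm_le_const ?_
  filter_upwards [hμ] with s hs
  rw [Real.norm_eq_abs, abs_of_nonneg (mul_nonneg (le_max_right _ _) (hw0 s))]
  have := hinge_bound hs 1
  rw [abs_one] at this
  calc _ ≤ 1 * w s := mul_le_mul_of_nonneg_right this (hw0 s)
    _ ≤ B := by simpa using hB s

/-- The lower bound for a concave function at the midpoint, in terms of its second derivative
on the middle half of the interval. -/
theorem hinge_half_add_le (hμ : ∀ᵐ s ∂μ, s ∈ Ioc (0 : ℝ) 1) (hw : Continuous w)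
    (hB : ∀ s, |w s| ≤ B) (hw0 : ∀ s, 0 ≤ w s) {m : ℝ} (hm0 : 0 ≤ m)
    (hm : ∀ s ∈ Icc (1 / 4 : ℝ) (3 / 4), m ≤ w s) (hmass : 1 / 2 ≤ μ.real (Icc (1 / 4) (3 / 4))) :
    hinge μ w (1 / 2) + m / 16 ≤ 1 / 2 * hinge μ w 1 := by
  have h1 := (integrable_hinge hμ hw hB 1).const_mul (1 / 2)
  have h2 := integrable_hinge hμ hw hB (1 / 2)
  have hI : Integrable ((Icc (1 / 4 : ℝ) (3 / 4)).indicator fun _ => m / 8) μ :=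
    (integrable_const _).indicator measurableSet_Icc
  have hle : ∫ s, (max (1 / 2 - s) 0 * w s + (Icc (1 / 4 : ℝ) (3 / 4)).indicator (fun _ => m / 8) s) ∂μ
      ≤ ∫ s, 1 / 2 * (max (1 - s) 0 * w s) ∂μ := by
    refine integral_mono_ae (h2.add hI) h1 ?_
    filter_upwards [hμ] with s hs
    rw [max_eq_left (by linarith [hs.2] : 0 ≤ 1 - s)]
    by_cases hs' : s ∈ Icc (1 / 4 : ℝ) (3 / 4)
    · rw [indicator_of_mem hs']
      have := hm s hs'
      have hk : max (1 / 2 - s) 0 ≤ 1 / 2 * (1 - s) - 1 / 8 :=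
        max_le (by linarith [hs'.1]) (by linarith [hs'.2])
      nlinarith [mul_le_mul_of_nonneg_right hk (hw0 s)]
    · rw [indicator_of_notMem hs', add_zero]
      have hk : max (1 / 2 - s) 0 ≤ 1 / 2 * (1 - s) :=
        max_le (by linarith [hs.1]) (by linarith [hs.2])
      nlinarith [mul_le_mul_of_nonneg_right hk (hw0 s)]
  rw [integral_add h2 hI, integral_const_mul, integral_indicator measurableSet_Icc,
    setIntegral_const, smul_eq_mul] at hle
  simp only [hinge]
  nlinarith

end Hinge

section Delay

variable {μ : Measure ℝ} {F : ℝ → ℝ → ℝ} {B : ℝ}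

theorem continuous_hinge [IsFiniteMeasure μ] (hμ : ∀ᵐ s ∂μ, s ∈ Ioc (0 : ℝ) 1) {w : ℝ → ℝ → ℝ}
    (hw : Continuous fun p : ℝ × ℝ => w p.1 p.2) (hB : ∀ c s, |w c s| ≤ B) :
    Continuous fun p : ℝ × ℝ => hinge μ (w p.1) p.2 := by
  refine continuous_iff_continuousAt.2 fun p₀ => ?_
  refine continuousAt_of_dominated (bound := fun _ => (|p₀.2| + 1) * B) ?_ ?_
    (integrable_const _) ?_
  · refine .of_forall fun p => Continuous.aestronglyMeasurable ?_
    have := hw.comp (continuous_const (y := p.1) |>.prodMk continuous_id)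
    exact (by fun_prop : Continuous fun s => max (p.2 - s) 0).mul this
  · have hev : ∀ᶠ p : ℝ × ℝ in 𝓝 p₀, |p.2| < |p₀.2| + 1 :=
      (continuous_snd.abs.tendsto p₀).eventually_lt_const (by simp)
    filter_upwards [hev] with p hp
    filter_upwards [hμ] with s hs
    rw [norm_mul, Real.norm_eq_abs, Real.norm_eq_abs, abs_of_nonneg (le_max_right _ _)]
    exact mul_le_mul ((hinge_bound hs _).trans hp.le) (hB _ _) (abs_nonneg _) (by positivity)
  · refine ae_of_all _ fun s => Continuous.continuousAt ?_
    have := hw.comp (by fun_prop : Continuous fun p : ℝ × ℝ => (p.1, s))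
    exact (by fun_prop : Continuous fun p : ℝ × ℝ => max (p.2 - s) 0).mul this

/-- Iterates of the integral operator of the delayed equation, with initial slope `c`. -/
noncomputable def delayIter (μ : Measure ℝ) (F : ℝ → ℝ → ℝ) (h : ℝ) : ℕ → ℝ → ℝ → ℝ
  | 0 => fun c t => c * t
  | k + 1 => fun c t => c * t - hinge μ (fun s => F s (delayIter μ F h k c (s - h))) t

theorem continuous_delayIter [IsFiniteMeasure μ] (hμ : ∀ᵐ s ∂μ, s ∈ Ioc (0 : ℝ) 1)
    (hF : Continuous fun p : ℝ × ℝ => F p.1 p.2) (hB : ∀ s u, |F s u| ≤ B) (h : ℝ) (k : ℕ) :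
    Continuous fun p : ℝ × ℝ => delayIter μ F h k p.1 p.2 := by
  induction k with
  | zero => exact continuous_fst.mul continuous_snd
  | succ k ih =>
    refine (continuous_fst.mul continuous_snd).sub
      (continuous_hinge hμ (w := fun c s => F s (delayIter μ F h k c (s - h))) ?_ fun _ _ => hB _ _)
    exact hF.comp (continuous_snd.prodMk
      (ih.comp (continuous_fst.prodMk (continuous_snd.sub continuous_const))))

theorem delayIter_succ_eq (hμ : ∀ᵐ s ∂μ, s ∈ Ioc (0 : ℝ) 1) (h : ℝ) (k : ℕ) (c : ℝ) {t : ℝ}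
    (ht : t ≤ k * h) : delayIter μ F h (k + 1) c t = delayIter μ F h k c t := by
  induction k generalizing t with
  | zero => simp [delayIter, hinge_of_nonpos hμ (by simpa using ht)]
  | succ k ih =>
    rw [delayIter, delayIter, sub_right_inj]
    refine integral_congr_ae (ae_of_all _ fun s => ?_)
    rcases le_total t s with hts | hst
    · simp [max_eq_right (sub_nonpos.2 hts)]
    · exact congrArg (fun v => max (t - s) 0 * F s v) (ih (by push_cast at ht; linarith))

theorem exists_delayed_solution [IsFiniteMeasure μ] (hμ : ∀ᵐ s ∂μ, s ∈ Ioc (0 : ℝ) 1)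
    (hF : Continuous fun p : ℝ × ℝ => F p.1 p.2) (hB : ∀ s u, |F s u| ≤ B) {h : ℝ} (hh : 0 < h) :
    ∃ X : ℝ → ℝ → ℝ, (Continuous fun p : ℝ × ℝ => X p.1 p.2) ∧
      ∀ c, ∀ t ≤ 1, X c t = c * t - hinge μ (fun s => F s (X c (s - h))) t := by
  obtain ⟨n, hn⟩ := exists_nat_ge (1 / h)
  refine ⟨delayIter μ F h n, continuous_delayIter hμ hF hB h n, fun c t ht => ?_⟩
  rw [← delayIter_succ_eq hμ h n c (ht.trans ((div_le_iff₀ hh).1 hn)), delayIter]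

variable {c h : ℝ} {x : ℝ → ℝ}

theorem concaveOn_of_eq_hinge [IsFiniteMeasure μ] (hμ : ∀ᵐ s ∂μ, s ∈ Ioc (0 : ℝ) 1) {w : ℝ → ℝ}
    (hw : Continuous w) (hB : ∀ s, |w s| ≤ B) (hw0 : ∀ s, 0 ≤ w s)
    (hx : ∀ t ≤ 1, x t = c * t - hinge μ w t) : ConcaveOn ℝ (Icc 0 1) x := by
  have h1 : ConcaveOn ℝ (Icc (0 : ℝ) 1) fun t => c * t - hinge μ w t :=
    ((LinearMap.mul ℝ ℝ c).concaveOn (convex_Icc 0 1)).sub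
      ((convexOn_hinge hμ hw hB hw0).subset (subset_univ _) (convex_Icc 0 1))
  exact h1.congr fun t ht => (hx t ht.2).symm

theorem nonneg_of_boundary {lam η : ℝ} (hlam0 : 0 ≤ lam) (hη : η ∈ Ioc (0 : ℝ) 1)
    (hκ : lam * (η ^ 2 / 2) < 1) (hx : ConcaveOn ℝ (Icc 0 1) x) (hc : Continuous x) (h0 : x 0 = 0)
    (h1 : x 1 = lam * ∫ t in (0 : ℝ)..η, x t) : ∀ t ∈ Icc (0 : ℝ) 1, 0 ≤ x t := by
  have := mul_le_mul_of_nonneg_left (hx.mul_le_integral hc h0 hη) hlam0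
  have h1' : 0 ≤ x 1 := by nlinarith
  exact fun t ht => hx.nonneg_of_endpoints h0.ge h1' ht

/-- Shooting: the delayed equation has a solution satisfying the nonlocal boundary condition. -/
theorem exists_delayed_bvp_solution [IsFiniteMeasure μ] (hμ : ∀ᵐ s ∂μ, s ∈ Ioc (0 : ℝ) 1)
    (hF : Continuous fun p : ℝ × ℝ => F p.1 p.2) (hF0 : ∀ s u, 0 ≤ F s u) (hB : ∀ s u, F s u ≤ B)
    {lam η R : ℝ} (hlam0 : 0 ≤ lam) (hη : η ∈ Ioc (0 : ℝ) 1) (hκ : lam * (η ^ 2 / 2) < 1)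
    (hR0 : 0 ≤ R) (hR : B * μ.real univ ≤ R * (1 - lam * (η ^ 2 / 2))) (hh : 0 < h) :
    ∃ c ∈ Icc 0 R, ∃ x : ℝ → ℝ, Continuous x ∧
      (∀ t ≤ 1, x t = c * t - hinge μ (fun s => F s (x (s - h))) t) ∧
      x 1 = lam * ∫ t in (0 : ℝ)..η, x t := by
  have hB' : ∀ s u, |F s u| ≤ B := fun s u => by rw [abs_of_nonneg (hF0 s u)]; exact hB s u
  obtain ⟨X, hXc, hX⟩ := exists_delayed_solution hμ hF hB' hh
  have hXcont : ∀ c, Continuous (X c) := fun c => hXc.comp (continuous_const.prodMk continuous_id)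
  have hG : Continuous fun c => X c 1 - lam * ∫ t in (0 : ℝ)..η, X c t :=
    (hXc.comp (continuous_id.prodMk continuous_const)).sub
      (continuous_const.mul
        (intervalIntegral.continuous_parametric_intervalIntegral_of_continuous' hXc 0 η))
  have hzero : ∀ c, X c 0 = 0 := fun c => by
    rw [hX c 0 zero_le_one, hinge_of_nonpos hμ le_rfl]; simp
  have hle : ∀ c, ∀ t ≤ 1, X c t ≤ c * t := fun c t ht => by
    rw [hX c t ht]; linarith [hinge_nonneg (μ := μ) (fun s => hF0 s (X c (s - h))) t]
  obtain ⟨c, hc, hcz⟩ := intermediate_value_Icc hR0 hG.continuousOn (show (0 : ℝ) ∈ _ from by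
    constructor
    · have hconc := concaveOn_of_eq_hinge hμ (w := fun s => F s (X 0 (s - h)))
        (hF.comp (continuous_id.prodMk ((hXcont 0).comp (continuous_id.sub continuous_const))))
        (fun _ => hB' _ _) (fun _ => hF0 _ _) (hX 0)
      have h1 := mul_le_mul_of_nonneg_left (hconc.mul_le_integral (hXcont 0) (hzero 0) hη) hlam0
      have h2 := hle 0 1 le_rfl
      nlinarith
    · have h1 : ∫ t in (0 : ℝ)..η, X R t ≤ ∫ t in (0 : ℝ)..η, R * t :=
        intervalIntegral.integral_mono_on hη.1.le ((hXcont R).intervalIntegrable _ _)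
          (Continuous.intervalIntegrable (by fun_prop) _ _) fun t ht => hle R t (ht.2.trans hη.2)
      rw [intervalIntegral.integral_const_mul, integral_id] at h1
      have h2 := mul_le_mul_of_nonneg_left h1 hlam0
      have h3 := hinge_one_le hμ (fun s => hF0 s (X R (s - h))) (fun s => hB s (X R (s - h)))
      have h4 := hX R 1 le_rfl
      nlinarith)
  exact ⟨c, hc, X c, hXcont c, hX c, sub_eq_zero.1 hcz⟩

/-- Nonnegative solutions of the delayed equation are bounded away from zero at the midpoint,
provided the nonlinearity is steep near zero. -/
theorem half_le_of_delayed [IsFiniteMeasure μ] (hμ : ∀ᵐ s ∂μ, s ∈ Ioc (0 : ℝ) 1)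
    (hF : Continuous fun p : ℝ × ℝ => F p.1 p.2) (hF0 : ∀ s u, 0 ≤ F s u) (hB : ∀ s u, F s u ≤ B)
    (hmass : 1 / 2 ≤ μ.real (Icc (1 / 4) (3 / 4))) {δ ε : ℝ} (hε : 0 < ε)
    (hδ : ∀ s ∈ Icc (0 : ℝ) 1, ∀ u ∈ Icc 0 δ, 64 * u + ε ≤ F s u) (hh : h ∈ Icc (0 : ℝ) (1 / 8))
    (hxc : Continuous x) (hx : ∀ t ≤ 1, x t = c * t - hinge μ (fun s => F s (x (s - h))) t)
    (hx0 : ∀ t ∈ Icc (0 : ℝ) 1, 0 ≤ x t) : δ / 2 ≤ x (1 / 2) := by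
  by_contra! hlt
  have hB' : ∀ s u, |F s u| ≤ B := fun s u => by rw [abs_of_nonneg (hF0 s u)]; exact hB s u
  have hw : Continuous fun s => F s (x (s - h)) :=
    hF.comp (continuous_id.prodMk (hxc.comp (continuous_id.sub continuous_const)))
  have hconc := concaveOn_of_eq_hinge hμ hw (fun _ => hB' _ _) (fun _ => hF0 _ _) hx
  have h0 := hx0 0 (by simp)
  have h1 := hx0 1 (by simp)
  have hhalf := hx0 (1 / 2) (by norm_num)
  have hup : ∀ t ∈ Icc (0 : ℝ) 1, x t ≤ δ := fun t ht => by
    have ht0 := hx0 t ht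
    rcases le_total t (1 / 2) with h' | h'
    · have := hconc.mul_le_mul_of_right_zero h1 ht.1 h' (by norm_num)
      nlinarith [mul_nonneg ht.1 hhalf]
    · have := hconc.mul_le_mul_of_left_zero h0 (by norm_num) h' ht.2
      nlinarith [mul_nonneg (sub_nonneg.2 ht.2) hhalf]
  have hlow : ∀ t ∈ Icc (1 / 8 : ℝ) (3 / 4), x (1 / 2) / 4 ≤ x t := fun t ht => by
    rcases le_total t (1 / 2) with h' | h'
    · have := hconc.mul_le_mul_of_left_zero h0 (by linarith [ht.1]) h' (by norm_num)
      nlinarith [mul_le_mul_of_nonneg_right ht.1 hhalf]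
    · have := hconc.mul_le_mul_of_right_zero h1 (by norm_num) h' (by linarith [ht.2])
      nlinarith [mul_le_mul_of_nonneg_right ht.2 hhalf]
  have hm : ∀ s ∈ Icc (1 / 4 : ℝ) (3 / 4), 16 * x (1 / 2) + ε ≤ F s (x (s - h)) := fun s hs => by
    have hs' : s - h ∈ Icc (1 / 8 : ℝ) (3 / 4) := ⟨by linarith [hs.1, hh.2], by linarith [hs.2, hh.1]⟩
    have hs'' : s - h ∈ Icc (0 : ℝ) 1 := ⟨by linarith [hs'.1], by linarith [hs'.2]⟩
    have := hδ s ⟨by linarith [hs.1], by linarith [hs.2]⟩ _ ⟨hx0 _ hs'', hup _ hs''⟩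
    linarith [hlow _ hs']
  have hkey := hinge_half_add_le hμ hw (fun _ => hB' _ _) (fun _ => hF0 _ _) (by positivity) hm hmass
  have e1 := hx 1 le_rfl
  have e2 := hx (1 / 2) (by norm_num)
  linarith

end Delay

theorem exists_hinge_bvp_solution {μ : Measure ℝ} [IsFiniteMeasure μ]
    (hμ : ∀ᵐ s ∂μ, s ∈ Ioc (0 : ℝ) 1) {F : ℝ → ℝ → ℝ} {B : ℝ}
    (hF : Continuous fun p : ℝ × ℝ => F p.1 p.2) (hF0 : ∀ s u, 0 ≤ F s u)
    (hB : ∀ s u, F s u + 1 ≤ B) {lam η R : ℝ} (hlam0 : 0 ≤ lam) (hη : η ∈ Ioc (0 : ℝ) 1)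
    (hκ : lam * (η ^ 2 / 2) < 1) (hR0 : 0 ≤ R)
    (hR : B * μ.real univ ≤ R * (1 - lam * (η ^ 2 / 2)))
    (hmass : 1 / 2 ≤ μ.real (Icc (1 / 4) (3 / 4))) {δ : ℝ}
    (hδ : ∀ s ∈ Icc (0 : ℝ) 1, ∀ u ∈ Icc 0 δ, 64 * u ≤ F s u) :
    ∃ (c : ℝ) (x : ℝ → ℝ), Continuous x ∧
      (∀ t ∈ Icc (0 : ℝ) 1, x t = c * t - hinge μ (fun s => F s (x s)) t) ∧
      (∀ t ∈ Icc (0 : ℝ) 1, x t ∈ Icc 0 R) ∧ δ / 2 ≤ x (1 / 2) ∧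
      x 1 = lam * ∫ t in (0 : ℝ)..η, x t := by
  let e : ℕ → ℝ := fun n => 1 / 8 * (1 / ((n : ℝ) + 1))
  have he0 : ∀ n, 0 < e n := fun n => by positivity
  have he1 : ∀ n, e n ≤ 1 / 8 := fun n => by
    have : 1 / ((n : ℝ) + 1) ≤ 1 := (div_le_one (by positivity)).2 (by linarith [n.cast_nonneg (α := ℝ)])
    simp only [e]; linarith
  have he : Tendsto e atTop (𝓝 0) := by
    simpa only [mul_zero] using
      (tendsto_one_div_add_atTop_nhds_zero_nat (𝕜 := ℝ)).const_mul (1 / 8)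
  have hFn : ∀ n, Continuous fun p : ℝ × ℝ => F p.1 p.2 + e n := fun n => hF.add continuous_const
  have hFn0 : ∀ n s u, 0 ≤ F s u + e n := fun n s u => by linarith [hF0 s u, he0 n]
  have hFnB : ∀ n s u, F s u + e n ≤ B := fun n s u => by linarith [hB s u, he1 n]
  have hFnB' : ∀ n s u, |F s u + e n| ≤ B := fun n s u => by
    rw [abs_of_nonneg (hFn0 n s u)]; exact hFnB n s u
  choose c hc x hxc hx hbc using fun n =>
    exists_delayed_bvp_solution (F := fun s u => F s u + e n) hμ (hFn n) (hFn0 n) (hFnB n)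
      hlam0 hη hκ hR0 hR (he0 n)
  have hw : ∀ n, Continuous fun s => F s (x n (s - e n)) + e n := fun n =>
    (hFn n).comp (continuous_id.prodMk ((hxc n).comp (continuous_id.sub continuous_const)))
  have hzero : ∀ n, x n 0 = 0 := fun n => by
    rw [hx n 0 zero_le_one, hinge_of_nonpos hμ le_rfl]; simp
  have hpos : ∀ n, ∀ t ∈ Icc (0 : ℝ) 1, 0 ≤ x n t := fun n =>
    nonneg_of_boundary hlam0 hη hκ (concaveOn_of_eq_hinge hμ (hw n) (fun _ => hFnB' n _ _)
      (fun _ => hFn0 n _ _) (hx n)) (hxc n) (hzero n) (hbc n)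
  have hup : ∀ n, ∀ t ∈ Icc (0 : ℝ) 1, x n t ≤ R := fun n t ht => by
    have h1 := hinge_nonneg (μ := μ) (fun s => hFn0 n s (x n (s - e n))) t
    have h2 : c n * t ≤ R * 1 := mul_le_mul (hc n).2 ht.2 ht.1 hR0
    rw [hx n t ht.2]
    linarith
  have hhalf : ∀ n, δ / 2 ≤ x n (1 / 2) := fun n =>
    half_le_of_delayed (F := fun s u => F s u + e n) hμ (hFn n) (hFn0 n) (hFnB n) hmass (he0 n)
      (fun s hs u hu => by linarith [hδ s hs u hu]) ⟨(he0 n).le, he1 n⟩ (hxc n) (hx n) (hpos n)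
  have hLip : ∀ n, ∀ s ≤ 1, ∀ t ≤ 1, |x n s - x n t| ≤ (R + B * μ.real univ) * |s - t| :=
    fun n s hs t ht => by
      have h1 := abs_hinge_sub_le hμ (hw n) (fun s => hFnB' n s (x n (s - e n))) s t
      have h2 : |c n * (s - t)| ≤ R * |s - t| := by
        rw [abs_mul, abs_of_nonneg (hc n).1]
        exact mul_le_mul_of_nonneg_right (hc n).2 (abs_nonneg _)
      rw [hx n s hs, hx n t ht]
      calc _ = |c n * (s - t) - (hinge μ (fun s => F s (x n (s - e n)) + e n) s -
              hinge μ (fun s => F s (x n (s - e n)) + e n) t)| := by congr 1; ring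
        _ ≤ _ := (abs_sub _ _).trans (by linarith)
  obtain ⟨g, φ, hg, hφ, hlim⟩ := exists_subseq_tendsto_of_equilipschitz x _ R
    (fun n s hs t ht => hLip n s hs.2 t ht.2) fun n t ht => by
      rw [abs_of_nonneg (hpos n t ht)]; exact hup n t ht
  obtain ⟨a, -, ψ, hψ, ha⟩ := isCompact_Icc.tendsto_subseq fun n => hc (φ n)
  have hχ : Tendsto (φ ∘ ψ) atTop atTop := (hφ.comp hψ).tendsto_atTop
  have hlim' : ∀ t ∈ Icc (0 : ℝ) 1, Tendsto (fun n => x (φ (ψ n)) t) atTop (𝓝 (g t)) :=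
    fun t ht => (hlim t ht).comp hψ.tendsto_atTop
  have heχ : Tendsto (fun n => e (φ (ψ n))) atTop (𝓝 0) := he.comp hχ
  refine ⟨a, g, hg, fun t ht => ?_, fun t ht => ?_, ?_, ?_⟩
  · refine tendsto_nhds_unique (hlim' t ht) ?_
    simp_rw [fun n => hx (φ (ψ n)) t ht.2]
    refine (ha.mul_const t).sub ?_
    refine tendsto_integral_of_dominated_convergence (fun _ => |t| * B)
      (fun n => (((continuous_const.sub continuous_id).max continuous_const).mul
        (hw _)).aestronglyMeasurable) (integrable_const _) (fun n => ?_) ?_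
    · filter_upwards [hμ] with s hs
      rw [norm_mul, Real.norm_eq_abs, Real.norm_eq_abs, abs_of_nonneg (le_max_right _ _)]
      exact mul_le_mul (hinge_bound hs _) (hFnB' _ _ _) (abs_nonneg _) (abs_nonneg _)
    · filter_upwards [hμ] with s hs
      have h1 : Tendsto (fun n => x (φ (ψ n)) (s - e (φ (ψ n)))) atTop (𝓝 (g s)) := by
        have h2 : Tendsto (fun n => x (φ (ψ n)) (s - e (φ (ψ n))) - x (φ (ψ n)) s) atTop (𝓝 0) := by
          refine squeeze_zero_norm (fun n => ?_)
            (by simpa using heχ.const_mul (R + B * μ.real univ))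
          refine (hLip _ _ (by linarith [hs.2, he0 (φ (ψ n))]) _ hs.2).trans_eq ?_
          rw [sub_sub_cancel_left, abs_neg, abs_of_pos (he0 _)]
        simpa using h2.add (hlim' s (Ioc_subset_Icc_self hs))
      have h3 : Tendsto (fun n => F s (x (φ (ψ n)) (s - e (φ (ψ n))))) atTop (𝓝 (F s (g s))) :=
        ((hF.comp (continuous_const.prodMk continuous_id)).tendsto (g s)).comp h1
      simpa using (h3.add heχ).const_mul (max (t - s) 0)
  · exact isClosed_Icc.mem_of_tendsto (hlim' t ht)
      (.of_forall fun n => ⟨hpos _ t ht, hup _ t ht⟩)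
  · exact ge_of_tendsto' (hlim' (1 / 2) (by norm_num)) fun n => hhalf _
  · refine tendsto_nhds_unique (hlim' 1 (by simp)) ?_
    simp_rw [fun n => hbc (φ (ψ n))]
    refine Tendsto.const_mul _ ?_
    refine intervalIntegral.tendsto_integral_filter_of_dominated_convergence (fun _ => R)
      (.of_forall fun n => (hxc _).aestronglyMeasurable) (.of_forall fun n => ?_)
      intervalIntegrable_const ?_
    · refine ae_of_all _ fun t ht => ?_
      rw [uIoc_of_le hη.1.le] at ht
      have ht' : t ∈ Icc (0 : ℝ) 1 := ⟨ht.1.le, ht.2.trans hη.2⟩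
      rw [Real.norm_eq_abs, abs_of_nonneg (hpos _ t ht')]
      exact hup _ t ht'
    · refine ae_of_all _ fun t ht => ?_
      rw [uIoc_of_le hη.1.le] at ht
      exact hlim' t ⟨ht.1.le, ht.2.trans hη.2⟩

section PowerWeight

variable {α : ℝ}

/-- The measure on `(0, 1]` with density `s ^ (α - 2)`. -/
noncomputable def powerWeight (α : ℝ) : Measure ℝ :=
  (volume.restrict (Ioc 0 1)).withDensity fun s => ENNReal.ofReal (s ^ (α - 2))

theorem isFiniteMeasure_powerWeight (hα : 1 < α) : IsFiniteMeasure (powerWeight α) :=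
  isFiniteMeasure_withDensity_ofReal
    (intervalIntegral.intervalIntegrable_rpow' (a := 0) (b := 1) (by linarith : -1 < α - 2)).1.2

theorem ae_mem_powerWeight (α : ℝ) : ∀ᵐ s ∂powerWeight α, s ∈ Ioc (0 : ℝ) 1 :=
  (withDensity_absolutelyContinuous _ _).ae_le (ae_restrict_mem measurableSet_Ioc)

theorem half_le_powerWeight (hα : α ∈ Ioc (1 : ℝ) 2) :
    1 / 2 ≤ (powerWeight α).real (Icc (1 / 4) (3 / 4)) := by
  have := isFiniteMeasure_powerWeight hα.1
  have h : ENNReal.ofReal (1 / 2) ≤ powerWeight α (Icc (1 / 4) (3 / 4)) := by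
    have hsub : Icc (1 / 4 : ℝ) (3 / 4) ⊆ Ioc 0 1 := fun s hs =>
      ⟨by linarith [hs.1], by linarith [hs.2]⟩
    rw [powerWeight, withDensity_apply _ measurableSet_Icc,
      Measure.restrict_restrict measurableSet_Icc, inter_eq_left.2 hsub]
    calc ENNReal.ofReal (1 / 2) = ∫⁻ _ in Icc (1 / 4 : ℝ) (3 / 4), 1 := by
          rw [setLIntegral_one, Real.volume_Icc]; norm_num
      _ ≤ _ := setLIntegral_mono' measurableSet_Icc fun s hs => by
          rw [ENNReal.one_le_ofReal]
          exact Real.one_le_rpow_of_pos_of_le_one_of_nonpos (by linarith [hs.1])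
            (by linarith [hs.2]) (by linarith [hα.2])
  exact (ENNReal.ofReal_le_iff_le_toReal (measure_ne_top _ _)).1 h

variable {w : ℝ → ℝ}

theorem intervalIntegrable_rpow_mul (hα : 1 < α) (hw : Continuous w) (a b : ℝ) :
    IntervalIntegrable (fun s => s ^ (α - 2) * w s) volume a b :=
  (intervalIntegral.intervalIntegrable_rpow' (by linarith)).mul_continuousOn hw.continuousOn

theorem hinge_powerWeight (hα : 1 < α) (hw : Continuous w) {t : ℝ} (ht : t ∈ Icc (0 : ℝ) 1) :
    hinge (powerWeight α) w t = t * (∫ s in (0 : ℝ)..t, s ^ (α - 2) * w s) -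
      ∫ s in (0 : ℝ)..t, s ^ (α - 2) * (s * w s) := by
  have hmeas : Measurable fun s : ℝ => ENNReal.ofReal (s ^ (α - 2)) := by fun_prop
  rw [← intervalIntegral.integral_const_mul, ← intervalIntegral.integral_sub
    ((intervalIntegrable_rpow_mul hα hw _ _).const_mul t)
    (intervalIntegrable_rpow_mul hα (w := fun s => s * w s) (by fun_prop) _ _),
    intervalIntegral.integral_of_le ht.1, hinge, powerWeight,
    integral_withDensity_eq_integral_toReal_smul hmeas (ae_of_all _ fun _ => ENNReal.ofReal_lt_top)]
  rw [setIntegral_eq_of_subset_of_forall_sdiff_eq_zero (s := Ioc 0 t) (t := Ioc 0 1)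
    measurableSet_Ioc (Ioc_subset_Ioc_right ht.2)]
  · refine setIntegral_congr_fun measurableSet_Ioc fun s hs => ?_
    rw [ENNReal.toReal_ofReal (Real.rpow_nonneg hs.1.le _), max_eq_left (by linarith [hs.2]),
      smul_eq_mul]
    ring
  · intro s hs
    have : t ≤ s := not_lt.1 fun h => hs.2 ⟨hs.1.1, h.le⟩
    rw [max_eq_right (by linarith), zero_mul, smul_zero]

theorem hasDerivAt_integral_rpow_mul (hα : 1 < α) (hw : Continuous w) {t : ℝ} (ht : 0 < t) :
    HasDerivAt (fun t => ∫ s in (0 : ℝ)..t, s ^ (α - 2) * w s) (t ^ (α - 2) * w t) t := by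
  have hc : ContinuousOn (fun s => s ^ (α - 2) * w s) (Ioi 0) :=
    (continuousOn_id.rpow_const fun s hs => Or.inl (ne_of_gt hs)).mul hw.continuousOn
  exact intervalIntegral.integral_hasDerivAt_right (intervalIntegrable_rpow_mul hα hw _ _)
    (hc.stronglyMeasurableAtFilter isOpen_Ioi t ht) (hc.continuousAt (Ioi_mem_nhds ht))

theorem differentiableAt_of_eq_hinge_powerWeight (hα : 1 < α) (hw : Continuous w) {x : ℝ → ℝ} {c : ℝ}
    (hx : ∀ t ∈ Icc (0 : ℝ) 1, x t = c * t - hinge (powerWeight α) w t) {t : ℝ}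
    (ht : t ∈ Ioo (0 : ℝ) 1) : DifferentiableAt ℝ x t ∧ DifferentiableAt ℝ (deriv x) t ∧
      t ^ (2 - α) * deriv (deriv x) t + w t = 0 := by
  have h1 : ∀ t ∈ Ioo (0 : ℝ) 1, HasDerivAt x (c - ∫ s in (0 : ℝ)..t, s ^ (α - 2) * w s) t := by
    intro t ht
    have hev : x =ᶠ[𝓝 t] fun t => c * t - (t * (∫ s in (0 : ℝ)..t, s ^ (α - 2) * w s) -
        ∫ s in (0 : ℝ)..t, s ^ (α - 2) * (s * w s)) := by
      filter_upwards [Ioo_mem_nhds ht.1 ht.2] with r hr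
      rw [hx r (Ioo_subset_Icc_self hr), hinge_powerWeight hα hw (Ioo_subset_Icc_self hr)]
    refine HasDerivAt.congr_of_eventuallyEq ?_ hev
    refine (((hasDerivAt_id' t).const_mul c).fun_sub
      (((hasDerivAt_id' t).fun_mul (hasDerivAt_integral_rpow_mul hα hw ht.1)).fun_sub
        (hasDerivAt_integral_rpow_mul hα (w := fun s => s * w s) (by fun_prop) ht.1))).congr_deriv ?_
    ring
  have h2 : HasDerivAt (deriv x) (-(t ^ (α - 2) * w t)) t := by
    refine ((hasDerivAt_integral_rpow_mul hα hw ht.1).const_sub c).congr_of_eventuallyEq ?_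
    filter_upwards [Ioo_mem_nhds ht.1 ht.2] with r hr
    exact (h1 r hr).deriv
  refine ⟨(h1 t ht).differentiableAt, h2.differentiableAt, ?_⟩
  have h3 : t ^ (2 - α) * t ^ (α - 2) = 1 := by
    rw [← Real.rpow_add ht.1]; simp
  rw [h2.deriv]
  linear_combination -w t * h3

end PowerWeight

section Growth

variable {f : ℝ → ℝ → ℝ}

theorem isCompact_image_div
    (hf : ContinuousOn (fun p : ℝ × ℝ => f p.1 p.2) (Icc 0 1 ×ˢ Ici 0)) {u : ℝ} (hu : 0 ≤ u) :
    IsCompact ((fun t => f t u / u) '' Icc (0 : ℝ) 1) :=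
  isCompact_Icc.image_of_continuousOn <| ContinuousOn.div_const
    (hf.comp (continuousOn_id.prodMk continuousOn_const) fun _ ht => ⟨ht, hu⟩) u

theorem exists_mul_le_of_tendsto_atTop
    (hf : ContinuousOn (fun p : ℝ × ℝ => f p.1 p.2) (Icc 0 1 ×ˢ Ici 0))
    (hfnn : ∀ t ∈ Icc (0 : ℝ) 1, ∀ u, 0 ≤ u → 0 ≤ f t u)
    (hf0 : Tendsto (fun u : ℝ => sInf ((fun t => f t u / u) '' Icc (0 : ℝ) 1)) (𝓝[>] 0) atTop)
    (M : ℝ) : ∃ δ > 0, ∀ t ∈ Icc (0 : ℝ) 1, ∀ u ∈ Icc 0 δ, M * u ≤ f t u := by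
  obtain ⟨δ, hδ, h⟩ := mem_nhdsGT_iff_exists_Ioc_subset.1 (hf0.eventually_ge_atTop M)
  refine ⟨δ, hδ, fun t ht u hu => ?_⟩
  rcases hu.1.eq_or_lt with rfl | hu0
  · simpa using hfnn t ht 0 le_rfl
  · rw [← le_div_iff₀ hu0]
    exact (h ⟨hu0, hu.2⟩ : M ≤ _).trans
      (csInf_le (isCompact_image_div hf hu.1).bddBelow (mem_image_of_mem _ ht))

theorem exists_bound_le_mul_of_tendsto_zero
    (hf : ContinuousOn (fun p : ℝ × ℝ => f p.1 p.2) (Icc 0 1 ×ˢ Ici 0))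
    (hfinf : Tendsto (fun u : ℝ => sSup ((fun t => f t u / u) '' Icc (0 : ℝ) 1)) atTop (𝓝 0))
    {τ : ℝ} (hτ : 0 < τ) :
    ∃ R > 0, ∀ t ∈ Icc (0 : ℝ) 1, ∀ u ∈ Icc 0 R, f t u + 1 ≤ R * τ := by
  obtain ⟨U, hU⟩ := eventually_atTop.1 (hfinf.eventually_le_const (half_pos hτ))
  obtain ⟨K, hK⟩ := ((isCompact_Icc.prod isCompact_Icc).image_of_continuousOn
    (hf.mono (prod_mono_right (Icc_subset_Ici_self (a := max U 1) (b := (0 : ℝ)))))).bddAbove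
  have hKR : K ≤ max K 1 * (2 / τ) * (τ / 2) := by
    rw [mul_assoc, div_mul_div_cancel₀ hτ.ne', div_self two_ne_zero, mul_one]
    exact le_max_left _ _
  have h1R : 1 ≤ max K 1 * (2 / τ) * (τ / 2) := by
    rw [mul_assoc, div_mul_div_cancel₀ hτ.ne', div_self two_ne_zero, mul_one]
    exact le_max_right _ _
  refine ⟨max K 1 * (2 / τ), by positivity, fun t ht u hu => ?_⟩
  rcases le_total u (max U 1) with huU | huU
  · linarith [hK (mem_image_of_mem _ (show (t, u) ∈ _ from ⟨ht, hu.1, huU⟩))]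
  · have hu0 : 0 < u := zero_lt_one.trans_le ((le_max_right _ _).trans huU)
    have h1 : f t u / u ≤ τ / 2 :=
      (le_csSup (isCompact_image_div hf hu.1).bddAbove (mem_image_of_mem _ ht)).trans
        (hU u ((le_max_left _ _).trans huU))
    rw [div_le_iff₀ hu0] at h1
    nlinarith [mul_le_mul_of_nonneg_right hu.2 (half_pos hτ).le]

end Growth

theorem stmt13 (α η lam : ℝ) (hα : α ∈ Set.Ioc (1 : ℝ) 2) (hη : η ∈ Set.Ioc (0 : ℝ) 1)
    (hlam0 : 0 ≤ lam) (hlam : lam < 2 / η ^ 2)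
    (f : ℝ → ℝ → ℝ)
    (hf : ContinuousOn (fun p : ℝ × ℝ => f p.1 p.2) (Set.Icc 0 1 ×ˢ Set.Ici 0))
    (hfnn : ∀ t ∈ Set.Icc (0 : ℝ) 1, ∀ u, 0 ≤ u → 0 ≤ f t u)
    -- `min_{t ∈ [0,1]} f(t,u)/u → ∞` as `u → 0⁺`
    (hf0 : Tendsto (fun u : ℝ => sInf ((fun t => f t u / u) '' Set.Icc (0 : ℝ) 1))
      (nhdsWithin 0 (Set.Ioi 0)) atTop)
    -- `max_{t ∈ [0,1]} f(t,u)/u → 0` as `u → ∞`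
    (hfinf : Tendsto (fun u : ℝ => sSup ((fun t => f t u / u) '' Set.Icc (0 : ℝ) 1))
      atTop (nhds 0)) :
    ∃ x : ℝ → ℝ, ContinuousOn x (Set.Icc 0 1) ∧
      (∀ t ∈ Set.Icc (0 : ℝ) 1, 0 ≤ x t) ∧
      (∃ t ∈ Set.Icc (0 : ℝ) 1, x t ≠ 0) ∧
      (∀ t ∈ Set.Ioo (0 : ℝ) 1, DifferentiableAt ℝ x t ∧ DifferentiableAt ℝ (deriv x) t ∧
        t ^ (2 - α) * deriv (deriv x) t + f t (x t) = 0) ∧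
      x 0 = 0 ∧ x 1 = lam * ∫ t in (0 : ℝ)..η, x t := by
  have hμ := ae_mem_powerWeight α
  have := isFiniteMeasure_powerWeight hα.1
  have hκ : lam * (η ^ 2 / 2) < 1 := by
    rw [lt_div_iff₀ (by have := hη.1; positivity)] at hlam
    linarith
  set m := (powerWeight α).real univ
  have hm : 0 ≤ m := measureReal_nonneg
  have hτ : 0 < (1 - lam * (η ^ 2 / 2)) / (m + 1) := div_pos (by linarith) (by linarith)
  obtain ⟨R, hR0, hR⟩ := exists_bound_le_mul_of_tendsto_zero hf hfinf hτ
  obtain ⟨δ, hδ0, hδ⟩ := exists_mul_le_of_tendsto_atTop hf hfnn hf0 64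
  let F : ℝ → ℝ → ℝ := fun s u => f (max 0 (min 1 s)) (max 0 (min R u))
  have hs : ∀ s : ℝ, max 0 (min 1 s) ∈ Icc (0 : ℝ) 1 := fun s =>
    ⟨le_max_left _ _, max_le zero_le_one (min_le_left _ _)⟩
  have hu : ∀ u : ℝ, max 0 (min R u) ∈ Icc 0 R := fun u =>
    ⟨le_max_left _ _, max_le hR0.le (min_le_left _ _)⟩
  have hFc : Continuous fun p : ℝ × ℝ => F p.1 p.2 :=
    hf.comp_continuous (f := fun p : ℝ × ℝ => (max 0 (min 1 p.1), max 0 (min R p.2)))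
      (by fun_prop) fun p => ⟨hs _, (hu _).1⟩
  have hFf : ∀ s ∈ Icc (0 : ℝ) 1, ∀ u ∈ Icc 0 R, F s u = f s u := fun s hs u hu => by
    simp only [F, min_eq_right hs.2, max_eq_right hs.1, min_eq_right hu.2, max_eq_right hu.1]
  obtain ⟨c, x, hxc, hx, hxR, hhalf, hbc⟩ := exists_hinge_bvp_solution hμ hFc
    (fun s u => hfnn _ (hs s) _ (hu u).1) (fun s u => hR _ (hs s) _ (hu u)) hlam0 hη hκ hR0.le
    (by
      rw [mul_assoc]
      refine mul_le_mul_of_nonneg_left ?_ hR0.le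
      rw [div_mul_eq_mul_div, div_le_iff₀ (by linarith)]
      nlinarith)
    (half_le_powerWeight hα) (δ := min δ R)
    (fun s hs u hu => by
      rw [hFf s hs u ⟨hu.1, hu.2.trans (min_le_right _ _)⟩]
      exact hδ s hs u ⟨hu.1, hu.2.trans (min_le_left _ _)⟩)
  refine ⟨x, hxc.continuousOn, fun t ht => (hxR t ht).1, ⟨1 / 2, by norm_num, ?_⟩, fun t ht => ?_,
    ?_, hbc⟩
  · exact ((half_pos (lt_min hδ0 hR0)).trans_le hhalf).ne'
  · have ht' := Ioo_subset_Icc_self ht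
    rw [← hFf t ht' (x t) (hxR t ht')]
    exact differentiableAt_of_eq_hinge_powerWeight hα.1 (w := fun s => F s (x s))
      (hFc.comp (continuous_id.prodMk hxc)) hx ht
  · rw [hx 0 (by simp), hinge_of_nonpos hμ le_rfl]
    simp
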